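/- Let n be even and let C_0 be the C-wave configuration of length n on H_n whose only interrupter is v_{0,2}. Then for every k ≥ 0, the configuration C_k of the 1/2-power index process is a wave configuration of length n, and C_k has an interrupter in column i (i.e., v_{i,1} or v_{i,2} is an interrupter of C_k) if and only if cell i is live at time t = k in the cylindrical cellular automaton of length n governed by Rule 90 seeded with a single live cell at index 0. -/

import Mathlib

open scoped Classical

/-- A strategy of a voter: collaborator (`C`) or defector (`D`). -/
inductive Strategy : Type
  | C : Strategy
  | D : Strategy
deriving DecidableEq

noncomputable section

variable {V : Type*}

/-- The closed neighbourhood `N[v]` of a vertex, as a finset. -/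
def closedNbhd (G : SimpleGraph V) [Fintype V] (v : V) : Finset V :=
  Finset.univ.filter fun u => u = v ∨ G.Adj u v

/-- The (Shapley–Shubik style) power of a vertex `v` in configuration `c`
with win condition `w`. -/
def power (G : SimpleGraph V) [Fintype V] (w : ℝ) (c : V → Strategy) (v : V) : ℝ :=
  let N := closedNbhd G v
  let nC := (N.filter fun u => c u = Strategy.C).card
  let nD := (N.filter fun u => c u = Strategy.D).card
  match c v with
  | Strategy.C => if w < (nC : ℝ) / (N.card : ℝ) then 1 / (nC : ℝ) else 0
  | Strategy.D => if (nC : ℝ) / (N.card : ℝ) ≤ w then 1 / (nD : ℝ) else 0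

/-- One step of the `w`-power index process: every vertex adopts the strategy of a
vertex of maximum power in its closed neighbourhood, retaining its own strategy if
vertices of maximum power have differing strategies. -/
def step (G : SimpleGraph V) [Fintype V] (w : ℝ) (c : V → Strategy) (v : V) : Strategy :=
  let N := closedNbhd G v
  let M := N.filter fun u => ∀ x ∈ N, power G w c x ≤ power G w c u
  if ∀ u ∈ M, c u = Strategy.C then Strategy.C
  else if ∀ u ∈ M, c u = Strategy.D then Strategy.D
  else c v

/-- `configSeq G w c0 i` is the configuration `C_i` of the `w`-power index process. -/
def configSeq (G : SimpleGraph V) [Fintype V] (w : ℝ) (c0 : V → Strategy) : ℕ → V → Strategy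
  | 0 => c0
  | k + 1 => step G w (configSeq G w c0 k)

/-- The process is eventually stable. -/
def EventuallyStable (G : SimpleGraph V) [Fintype V] (w : ℝ) (c0 : V → Strategy) : Prop :=
  ∃ i, configSeq G w c0 (i + 1) = configSeq G w c0 i

/-- The process reaches a stable all-collaborator configuration. -/
def CollaboratorDominant (G : SimpleGraph V) [Fintype V] (w : ℝ) (c0 : V → Strategy) : Prop :=
  ∃ i, configSeq G w c0 (i + 1) = configSeq G w c0 i ∧
    ∀ v, configSeq G w c0 i v = Strategy.C

/-- The process reaches a stable all-defector configuration. -/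
def DefectorDominant (G : SimpleGraph V) [Fintype V] (w : ℝ) (c0 : V → Strategy) : Prop :=
  ∃ i, configSeq G w c0 (i + 1) = configSeq G w c0 i ∧
    ∀ v, configSeq G w c0 i v = Strategy.D

/-- The process is eventually periodic with period `ℓ`: `ℓ > 1` is the least integer
such that `C_i = C_{i+ℓ}` for some `i ≥ 0`. -/
def EventuallyPeriodicWithPeriod (G : SimpleGraph V) [Fintype V] (w : ℝ)
    (c0 : V → Strategy) (ℓ : ℕ) : Prop :=
  IsLeast {m : ℕ | 1 < m ∧ ∃ i, configSeq G w c0 (i + m) = configSeq G w c0 i} ℓ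

end

/-- Vertices of the graph `H_n`: a pair `(i, (j, t))` where `i ∈ ℤ/n` is the column,
`j ∈ {0, 1}` is the row (row `0` is row "1" of the paper, row `1` is row "2"),
and `t` records the kind of vertex: `t = 0` is `v_{i,j}` (a vertex of `C_n □ P_2`),
`t = 1` is `z_{i,j}` (the triangle vertex joined to `v_{i,j}`), and `t = 2, 3`
are `x_{i,j}, y_{i,j}` (the other two triangle vertices). -/
abbrev HVertex (n : ℕ) : Type := ZMod n × Fin 2 × Fin 4

/-- The graph `H_n`, obtained from `C_n □ P_2` by attaching, to each vertex
`v_{i,j}`, a pendant triangle `x_{i,j} y_{i,j} z_{i,j}` via the edge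
`v_{i,j} z_{i,j}`. -/
def Hgraph (n : ℕ) : SimpleGraph (HVertex n) :=
  SimpleGraph.fromRel fun a b =>
    -- cycle edges of each row: v_{i,j} ~ v_{i+1,j}
    (a.2.2 = 0 ∧ b.2.2 = 0 ∧ a.2.1 = b.2.1 ∧ b.1 = a.1 + 1) ∨
    -- rung edges: v_{i,0} ~ v_{i,1}
    (a.2.2 = 0 ∧ b.2.2 = 0 ∧ a.1 = b.1 ∧ a.2.1 ≠ b.2.1) ∨
    -- triangle edges among x, y, z at the same (i, j)
    (a.1 = b.1 ∧ a.2.1 = b.2.1 ∧ a.2.2 ≠ 0 ∧ b.2.2 ≠ 0) ∨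
    -- pendant edges: v_{i,j} ~ z_{i,j}
    (a.1 = b.1 ∧ a.2.1 = b.2.1 ∧ a.2.2 = 0 ∧ b.2.2 = 1)

/-- The configuration `W` on `H_n`: all vertices of row `0` (the paper's row `1`)
are collaborators, all vertices of row `1` (the paper's row `2`) are defectors. -/
def Wconfig (n : ℕ) : HVertex n → Strategy :=
  fun a => if a.2.1 = 0 then Strategy.C else Strategy.D

noncomputable section

/-- The `C`-wave configuration on `H_n` with interrupter columns `I`: the
configuration `W` with the strategies of the vertices `v_{i,2}` (`i ∈ I`) flipped
from `D` to `C`. -/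
def CwaveConfig (n : ℕ) (I : Set (ZMod n)) : HVertex n → Strategy :=
  fun a => if a.2.1 = 0 then Strategy.C
    else if a.2.2 = 0 ∧ a.1 ∈ I then Strategy.C else Strategy.D

/-- The `D`-wave configuration on `H_n` with interrupter columns `I`: the
configuration `W` with the strategies of the vertices `v_{i,1}` (`i ∈ I`) flipped
from `C` to `D`. -/
def DwaveConfig (n : ℕ) (I : Set (ZMod n)) : HVertex n → Strategy :=
  fun a => if a.2.1 = 0 then
    (if a.2.2 = 0 ∧ a.1 ∈ I then Strategy.D else Strategy.C) else Strategy.D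

/-- A set of interrupter columns is admissible for a wave configuration when all its
columns have the same parity. -/
def SameParity {n : ℕ} (I : Set (ZMod n)) : Prop :=
  ∃ p : ZMod 2, ∀ i ∈ I, ((i.val : ℕ) : ZMod 2) = p

end

/-- The cylindrical cellular automaton of length `n` governed by Rule 90:
`rule90 n seed t i = true` iff cell `i` is live at time `t`, where a cell is live at
time `t+1` iff exactly one of its two neighbours was live at time `t`. -/
def rule90 (n : ℕ) (seed : ZMod n → Bool) : ℕ → ZMod n → Bool
  | 0 => seed
  | t + 1 => fun i => xor (rule90 n seed t (i - 1)) (rule90 n seed t (i + 1))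


section Helpers

variable {V : Type*} [Fintype V]

lemma mem_closedNbhd_iff (G : SimpleGraph V) (u v : V) :
    u ∈ closedNbhd G v ↔ u = v ∨ G.Adj u v := by
  simp [closedNbhd]

lemma exists_max_nbhd (G : SimpleGraph V) (w : ℝ) (c : V → Strategy) (v : V) :
    ∃ u ∈ closedNbhd G v, ∀ x ∈ closedNbhd G v, power G w c x ≤ power G w c u :=
  Finset.exists_max_image _ _ ⟨v, by simp [closedNbhd]⟩

lemma step_eq_of_lt (G : SimpleGraph V) (w : ℝ) (c : V → Strategy) (v x : V) (s : Strategy)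
    (hx : x ∈ closedNbhd G v)
    (h : ∀ u ∈ closedNbhd G v, c u ≠ s → power G w c u < power G w c x) :
    step G w c v = s := by
  obtain ⟨m, hm, hmax⟩ := exists_max_nbhd G w c v
  have key : ∀ u ∈ (closedNbhd G v).filter
      (fun u => ∀ x ∈ closedNbhd G v, power G w c x ≤ power G w c u), c u = s := by
    intro u hu
    rw [Finset.mem_filter] at hu
    by_contra hne
    exact absurd (h u hu.1 hne) (not_lt.mpr (hu.2 x hx))
  have hmm : m ∈ (closedNbhd G v).filter
      (fun u => ∀ x ∈ closedNbhd G v, power G w c x ≤ power G w c u) :=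
    Finset.mem_filter.mpr ⟨hm, hmax⟩
  unfold step
  cases s with
  | C => exact if_pos key
  | D =>
    have : ¬ ∀ u ∈ (closedNbhd G v).filter
      (fun u => ∀ x ∈ closedNbhd G v, power G w c x ≤ power G w c u), c u = Strategy.C := by
      intro hC
      have h1 := hC m hmm
      rw [key m hmm] at h1
      exact Strategy.noConfusion h1
    exact (if_neg this).trans (if_pos key)

lemma step_eq_of_le (G : SimpleGraph V) (w : ℝ) (c : V → Strategy) (v x : V) (s : Strategy)
    (hv : c v = s) (hx : x ∈ closedNbhd G v) (hxs : c x = s)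
    (h : ∀ u ∈ closedNbhd G v, c u ≠ s → power G w c u ≤ power G w c x) :
    step G w c v = s := by
  obtain ⟨m, hm, hmax⟩ := exists_max_nbhd G w c v
  have key : ∃ u ∈ (closedNbhd G v).filter
      (fun u => ∀ x ∈ closedNbhd G v, power G w c x ≤ power G w c u), c u = s := by
    by_cases hms : c m = s
    · exact ⟨m, Finset.mem_filter.mpr ⟨hm, hmax⟩, hms⟩
    · exact ⟨x, Finset.mem_filter.mpr ⟨hx, fun y hy => (hmax y hy).trans (h m hm hms)⟩, hxs⟩
  obtain ⟨u, hu, hus⟩ := key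
  unfold step
  simp only
  split_ifs with h1 h2
  · rw [← hus, h1 u hu]
  · rw [← hus, h2 u hu]
  · exact hv

end Helpers

section Wave

variable {n : ℕ} [NeZero n]

lemma zmod_facts (hn : 3 ≤ n) (i : ZMod n) :
    i - 1 ≠ i ∧ i + 1 ≠ i ∧ i - 1 ≠ i + 1 := by
  have : Fact (1 < n) := ⟨by omega⟩
  have : Fact (2 < n) := ⟨by omega⟩
  have h2 : (2 : ZMod n) ≠ 0 := by
    intro h
    have : ((2 : ℕ) : ZMod n) = 0 := by exact_mod_cast h
    rw [ZMod.natCast_eq_zero_iff] at this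
    have := Nat.le_of_dvd (by norm_num) this
    omega
  refine ⟨by simp, by simp, fun h => h2 ?_⟩
  linear_combination -h

lemma nbhd_v (i : ZMod n) (hn : 3 ≤ n) (j : Fin 2) : closedNbhd (Hgraph n) (i, j, 0) =
    {(i, j, 0), (i - 1, j, 0), (i + 1, j, 0), (i, j + 1, 0), (i, j, 1)} := by
  obtain ⟨h1, h2, h3⟩ := zmod_facts hn i
  ext ⟨a, b, t⟩
  rw [mem_closedNbhd_iff]
  simp only [Hgraph, SimpleGraph.fromRel_adj, Finset.mem_insert, Finset.mem_singleton,
    Prod.mk.injEq, ne_eq]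
  have e1 : i = a + 1 ↔ a = i - 1 := by
    constructor <;> intro h <;> rw [h] <;> ring
  rw [e1]
  clear e1
  by_cases ha : a = i
  · subst ha
    have := Ne.symm h1
    have := Ne.symm h2
    fin_cases j <;> fin_cases b <;> fin_cases t <;> simp_all
  · have := Ne.symm ha
    by_cases ha1 : a = i - 1
    · subst ha1
      fin_cases j <;> fin_cases b <;> fin_cases t <;> simp_all
    · fin_cases j <;> fin_cases b <;> fin_cases t <;> simp_all

lemma nbhd_z (i : ZMod n) (j : Fin 2) : closedNbhd (Hgraph n) (i, j, 1) =
    {(i, j, 0), (i, j, 1), (i, j, 2), (i, j, 3)} := by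
  ext ⟨a, b, t⟩
  rw [mem_closedNbhd_iff]
  simp only [Hgraph, SimpleGraph.fromRel_adj, Finset.mem_insert, Finset.mem_singleton,
    Prod.mk.injEq, ne_eq]
  by_cases ha : a = i
  · subst ha
    fin_cases j <;> fin_cases b <;> fin_cases t <;> simp
  · have := Ne.symm ha
    fin_cases j <;> fin_cases b <;> fin_cases t <;> simp_all

lemma nbhd_x (i : ZMod n) (j : Fin 2) (t : Fin 4) (ht : t = 2 ∨ t = 3) :
    closedNbhd (Hgraph n) (i, j, t) =
    {(i, j, 1), (i, j, 2), (i, j, 3)} := by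
  ext ⟨a, b, s⟩
  rw [mem_closedNbhd_iff]
  simp only [Hgraph, SimpleGraph.fromRel_adj, Finset.mem_insert, Finset.mem_singleton,
    Prod.mk.injEq, ne_eq]
  by_cases ha : a = i
  · subst ha
    rcases ht with rfl | rfl <;>
    fin_cases j <;> fin_cases b <;> fin_cases s <;> simp
  · have := Ne.symm ha
    rcases ht with rfl | rfl <;>
    fin_cases j <;> fin_cases b <;> fin_cases s <;> simp_all

lemma count_v (i : ZMod n) (hn : 3 ≤ n) (j : Fin 2) (P : HVertex n → Prop) [DecidablePred P] :
    ((closedNbhd (Hgraph n) (i, j, 0)).filter P).card =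
      (if P (i, j, 0) then 1 else 0) + ((if P (i - 1, j, 0) then 1 else 0) +
      ((if P (i + 1, j, 0) then 1 else 0) + ((if P (i, j + 1, 0) then 1 else 0) +
      (if P (i, j, 1) then 1 else 0)))) := by
  obtain ⟨h1, h2, h3⟩ := zmod_facts hn i
  have := Ne.symm h1
  have := Ne.symm h2
  rw [nbhd_v i hn, Finset.card_filter]
  rw [Finset.sum_insert, Finset.sum_insert, Finset.sum_insert, Finset.sum_insert,
    Finset.sum_singleton] <;> fin_cases j <;> simp_all

lemma count_z (i : ZMod n) (j : Fin 2) (P : HVertex n → Prop) [DecidablePred P] :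
    ((closedNbhd (Hgraph n) (i, j, 1)).filter P).card =
      (if P (i, j, 0) then 1 else 0) + ((if P (i, j, 1) then 1 else 0) +
      ((if P (i, j, 2) then 1 else 0) + (if P (i, j, 3) then 1 else 0))) := by
  rw [nbhd_z i, Finset.card_filter]
  rw [Finset.sum_insert, Finset.sum_insert, Finset.sum_insert,
    Finset.sum_singleton] <;> simp

lemma count_x (i : ZMod n) (j : Fin 2) (t : Fin 4) (ht : t = 2 ∨ t = 3)
    (P : HVertex n → Prop) [DecidablePred P] :
    ((closedNbhd (Hgraph n) (i, j, t)).filter P).card =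
      (if P (i, j, 1) then 1 else 0) +
      ((if P (i, j, 2) then 1 else 0) + (if P (i, j, 3) then 1 else 0)) := by
  rw [nbhd_x i j t ht, Finset.card_filter]
  rw [Finset.sum_insert, Finset.sum_insert,
    Finset.sum_singleton] <;> simp

lemma card_v (i : ZMod n) (hn : 3 ≤ n) (j : Fin 2) :
    (closedNbhd (Hgraph n) (i, j, 0)).card = 5 := by
  simpa using count_v i hn j (fun _ => True)

lemma card_z (i : ZMod n) (j : Fin 2) :
    (closedNbhd (Hgraph n) (i, j, 1)).card = 4 := by
  simpa using count_z i j (fun _ => True)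

lemma card_x (i : ZMod n) (j : Fin 2) (t : Fin 4) (ht : t = 2 ∨ t = 3) :
    (closedNbhd (Hgraph n) (i, j, t)).card = 3 := by
  simpa using count_x i j t ht (fun _ => True)

/-! Values of the configurations. -/

variable (I : Set (ZMod n))

lemma cw0 (i : ZMod n) (t : Fin 4) : CwaveConfig n I (i, 0, t) = Strategy.C := by
  simp [CwaveConfig]
lemma cw1 (i : ZMod n) (t : Fin 4) (ht : t ≠ 0) : CwaveConfig n I (i, 1, t) = Strategy.D := by
  simp [CwaveConfig, ht]
lemma cwv (i : ZMod n) :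
    CwaveConfig n I (i, 1, 0) = if i ∈ I then Strategy.C else Strategy.D := by
  simp [CwaveConfig]
lemma dw1 (i : ZMod n) (t : Fin 4) : DwaveConfig n I (i, 1, t) = Strategy.D := by
  simp [DwaveConfig]
lemma dw0 (i : ZMod n) (t : Fin 4) (ht : t ≠ 0) : DwaveConfig n I (i, 0, t) = Strategy.C := by
  simp [DwaveConfig, ht]
lemma dwv (i : ZMod n) :
    DwaveConfig n I (i, 0, 0) = if i ∈ I then Strategy.D else Strategy.C := by
  simp [DwaveConfig]

/-! Powers in a `C`-wave. -/

lemma pc_v0 (hn : 3 ≤ n) (i : ZMod n) :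
    power (Hgraph n) (1 / 2) (CwaveConfig n I) (i, 0, 0) = if i ∈ I then 1 / 5 else 1 / 4 := by
  by_cases h : i ∈ I <;>
  simp [power, count_v, card_v, hn, cw0, cwv, h, cw1] <;> norm_num

lemma pc_z0 (i : ZMod n) :
    power (Hgraph n) (1 / 2) (CwaveConfig n I) (i, 0, 1) = 1 / 4 := by
  simp [power, count_z, card_z, cw0] ; norm_num

lemma pc_v1 (hn : 3 ≤ n) (i : ZMod n) (hI : i ∈ I → i - 1 ∉ I ∧ i + 1 ∉ I) :
    power (Hgraph n) (1 / 2) (CwaveConfig n I) (i, 1, 0) =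
      if i ∈ I then 0 else if i - 1 ∈ I then (if i + 1 ∈ I then 0 else 1 / 3)
        else (if i + 1 ∈ I then 1 / 3 else 1 / 4) := by
  by_cases h : i ∈ I <;> by_cases h1 : i - 1 ∈ I <;> by_cases h2 : i + 1 ∈ I <;>
  simp [power, count_v, card_v, hn, cw0, cwv, cw1, h, h1, h2] at hI ⊢ <;> norm_num

lemma pc_z1 (i : ZMod n) :
    power (Hgraph n) (1 / 2) (CwaveConfig n I) (i, 1, 1) = if i ∈ I then 1 / 3 else 1 / 4 := by
  by_cases h : i ∈ I <;>
  simp [power, count_z, card_z, cw1, cwv, h] <;> norm_num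

lemma pc_x1 (i : ZMod n) (t : Fin 4) (ht : t = 2 ∨ t = 3) :
    power (Hgraph n) (1 / 2) (CwaveConfig n I) (i, 1, t) = 1 / 3 := by
  have h0 : t ≠ 0 := by rcases ht with rfl | rfl <;> simp
  simp [power, count_x, card_x, cw1, ht, h0]

/-! Powers in a `D`-wave. -/

lemma pd_v1 (hn : 3 ≤ n) (i : ZMod n) :
    power (Hgraph n) (1 / 2) (DwaveConfig n I) (i, 1, 0) = if i ∈ I then 1 / 5 else 1 / 4 := by
  by_cases h : i ∈ I <;>
  simp [power, count_v, card_v, hn, dw0, dwv, h, dw1] <;> norm_num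

lemma pd_z1 (i : ZMod n) :
    power (Hgraph n) (1 / 2) (DwaveConfig n I) (i, 1, 1) = 1 / 4 := by
  simp [power, count_z, card_z, dw1]

lemma pd_v0 (hn : 3 ≤ n) (i : ZMod n) (hI : i ∈ I → i - 1 ∉ I ∧ i + 1 ∉ I) :
    power (Hgraph n) (1 / 2) (DwaveConfig n I) (i, 0, 0) =
      if i ∈ I then 0 else if i - 1 ∈ I then (if i + 1 ∈ I then 0 else 1 / 3)
        else (if i + 1 ∈ I then 1 / 3 else 1 / 4) := by
  by_cases h : i ∈ I <;> by_cases h1 : i - 1 ∈ I <;> by_cases h2 : i + 1 ∈ I <;>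
  simp [power, count_v, card_v, hn, dw0, dwv, dw1, h, h1, h2] at hI ⊢ <;> norm_num

lemma pd_z0 (i : ZMod n) :
    power (Hgraph n) (1 / 2) (DwaveConfig n I) (i, 0, 1) = if i ∈ I then 1 / 3 else 1 / 4 := by
  by_cases h : i ∈ I <;>
  simp [power, count_z, card_z, dw0, dwv, h] <;> norm_num

lemma pd_x0 (i : ZMod n) (t : Fin 4) (ht : t = 2 ∨ t = 3) :
    power (Hgraph n) (1 / 2) (DwaveConfig n I) (i, 0, t) = 1 / 3 := by
  have h0 : t ≠ 0 := by rcases ht with rfl | rfl <;> simp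
  simp [power, count_x, card_x, dw0, ht, h0] ; norm_num

lemma fin4_cases (t : Fin 4) : t = 0 ∨ t = 1 ∨ (t = 2 ∨ t = 3) := by
  fin_cases t <;> simp

lemma step_Cwave (hn : 3 ≤ n) (hI : ∀ i ∈ I, i - 1 ∉ I ∧ i + 1 ∉ I) :
    step (Hgraph n) (1 / 2) (CwaveConfig n I) =
      DwaveConfig n {i | Xor (i - 1 ∈ I) (i + 1 ∈ I)} := by
  funext ⟨i, j, t⟩
  have hj : j = 0 ∨ j = 1 := by fin_cases j <;> simp
  rcases hj with rfl | rfl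
  · rcases fin4_cases t with rfl | rfl | ht
    · rw [dwv]
      by_cases hx : Xor (i - 1 ∈ I) (i + 1 ∈ I)
      · have hiI : i ∉ I := fun h => by
          have := hI i h
          rcases hx with ⟨h1, -⟩ | ⟨h1, -⟩
          · exact this.1 h1
          · exact this.2 h1
        rw [if_pos (by exact hx)]
        have hp : power (Hgraph n) (1 / 2) (CwaveConfig n I) (i, 1, 0) = 1 / 3 := by
          rw [pc_v1 I hn i (hI i), if_neg hiI]
          rcases hx with ⟨h1, h2⟩ | ⟨h1, h2⟩ <;> simp [h1, h2]
        apply step_eq_of_lt _ _ _ _ (i, 1, 0)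
        · rw [nbhd_v i hn]; simp
        · rw [nbhd_v i hn, hp]
          simp only [Finset.mem_insert, Finset.mem_singleton]
          rintro u (rfl | rfl | rfl | rfl | rfl) hu
          · rw [pc_v0 I hn]; split_ifs <;> norm_num
          · rw [pc_v0 I hn]; split_ifs <;> norm_num
          · rw [pc_v0 I hn]; split_ifs <;> norm_num
          · simp [cwv, hiI] at hu
          · rw [pc_z0]; norm_num
      · rw [if_neg (by exact hx)]
        apply step_eq_of_le _ _ _ _ (i, 0, 1) _ (cw0 I _ _) _ (cw0 I _ _)
        · rw [nbhd_v i hn, pc_z0]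
          simp only [Finset.mem_insert, Finset.mem_singleton]
          rintro u (rfl | rfl | rfl | rfl | rfl) hu
          · simp [cw0] at hu
          · simp [cw0] at hu
          · simp [cw0] at hu
          · rw [show ((0 : Fin 2) + 1) = 1 from rfl, pc_v1 I hn i (hI i)]
            by_cases h1 : i - 1 ∈ I <;> by_cases h2 : i + 1 ∈ I <;>
              simp [h1, h2, Xor] at hx ⊢
            split_ifs <;> norm_num
          · simp [cw0] at hu
        · rw [nbhd_v i hn]; simp
    · rw [dw0 _ _ _ (by simp)]
      apply step_eq_of_le _ _ _ _ (i, 0, 1) _ (cw0 I _ _) _ (cw0 I _ _)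
      · rw [nbhd_z]
        simp only [Finset.mem_insert, Finset.mem_singleton]
        rintro u (rfl | rfl | rfl | rfl) hu <;> simp [cw0] at hu
      · rw [nbhd_z]; simp
    · rw [dw0 _ _ _ (by rcases ht with rfl | rfl <;> simp)]
      apply step_eq_of_le _ _ _ _ (i, 0, 1) _ (cw0 I _ _) _ (cw0 I _ _)
      · rw [nbhd_x _ _ _ ht]
        simp only [Finset.mem_insert, Finset.mem_singleton]
        rintro u (rfl | rfl | rfl) hu <;> simp [cw0] at hu
      · rw [nbhd_x _ _ _ ht]; simp
  · rw [dw1]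
    rcases fin4_cases t with rfl | rfl | ht
    · by_cases hi : i ∈ I
      · apply step_eq_of_lt _ _ _ _ (i, 1, 1)
        · rw [nbhd_v i hn]; simp
        · rw [nbhd_v i hn, pc_z1, if_pos hi]
          simp only [Finset.mem_insert, Finset.mem_singleton]
          rintro u (rfl | rfl | rfl | rfl | rfl) hu
          · rw [pc_v1 I hn i (hI i), if_pos hi]; norm_num
          · simp [cwv, hI i hi] at hu
          · simp [cwv, hI i hi] at hu
          · rw [show ((1 : Fin 2) + 1) = 0 from rfl, pc_v0 I hn]; split_ifs <;> norm_num
          · simp [cw1] at hu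
      · apply step_eq_of_le _ _ _ _ (i, 1, 1) _ (by simp [cwv, hi]) _ (cw1 I _ _ (by simp))
        · rw [nbhd_v i hn, pc_z1, if_neg hi]
          simp only [Finset.mem_insert, Finset.mem_singleton]
          rintro u (rfl | rfl | rfl | rfl | rfl) hu
          · simp [cwv, hi] at hu
          · have : i - 1 ∈ I := by
              by_contra h; simp [cwv, h] at hu
            rw [pc_v1 I hn _ (hI _), if_pos this]; norm_num
          · have : i + 1 ∈ I := by
              by_contra h; simp [cwv, h] at hu
            rw [pc_v1 I hn _ (hI _), if_pos this]; norm_num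
          · rw [show ((1 : Fin 2) + 1) = 0 from rfl, pc_v0 I hn]; split_ifs <;> norm_num
          · simp [cw1] at hu
        · rw [nbhd_v i hn]; simp
    · apply step_eq_of_lt _ _ _ _ (i, 1, 2)
      · rw [nbhd_z]; simp
      · rw [nbhd_z, pc_x1 _ _ _ (Or.inl rfl)]
        simp only [Finset.mem_insert, Finset.mem_singleton]
        rintro u (rfl | rfl | rfl | rfl) hu
        · have : i ∈ I := by
            by_contra h; simp [cwv, h] at hu
          rw [pc_v1 I hn _ (hI _), if_pos this]; norm_num
        · simp [cw1] at hu
        · simp [cw1] at hu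
        · simp [cw1] at hu
    · have h0 : t ≠ 0 := by rcases ht with rfl | rfl <;> simp
      apply step_eq_of_le _ _ _ _ (i, 1, 1) _ (cw1 I _ _ h0) _ (cw1 I _ _ (by simp))
      · rw [nbhd_x _ _ _ ht]
        simp only [Finset.mem_insert, Finset.mem_singleton]
        rintro u (rfl | rfl | rfl) hu <;> simp [cw1] at hu
      · rw [nbhd_x _ _ _ ht]; simp

lemma step_Dwave (hn : 3 ≤ n) (hI : ∀ i ∈ I, i - 1 ∉ I ∧ i + 1 ∉ I) :
    step (Hgraph n) (1 / 2) (DwaveConfig n I) =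
      CwaveConfig n {i | Xor (i - 1 ∈ I) (i + 1 ∈ I)} := by
  funext ⟨i, j, t⟩
  have hj : j = 1 ∨ j = 0 := by fin_cases j <;> simp
  rcases hj with rfl | rfl
  · rcases fin4_cases t with rfl | rfl | ht
    · rw [cwv]
      by_cases hx : Xor (i - 1 ∈ I) (i + 1 ∈ I)
      · have hiI : i ∉ I := fun h => by
          have := hI i h
          rcases hx with ⟨h1, -⟩ | ⟨h1, -⟩
          · exact this.1 h1
          · exact this.2 h1
        rw [if_pos (by exact hx)]
        have hp : power (Hgraph n) (1 / 2) (DwaveConfig n I) (i, 0, 0) = 1 / 3 := by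
          rw [pd_v0 I hn i (hI i), if_neg hiI]
          rcases hx with ⟨h1, h2⟩ | ⟨h1, h2⟩ <;> simp [h1, h2]
        apply step_eq_of_lt _ _ _ _ (i, 0, 0)
        · rw [nbhd_v i hn]; simp
        · rw [nbhd_v i hn, hp]
          simp only [Finset.mem_insert, Finset.mem_singleton]
          rintro u (rfl | rfl | rfl | rfl | rfl) hu
          · rw [pd_v1 I hn]; split_ifs <;> norm_num
          · rw [pd_v1 I hn]; split_ifs <;> norm_num
          · rw [pd_v1 I hn]; split_ifs <;> norm_num
          · simp [dwv, hiI] at hu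
          · rw [pd_z1]; norm_num
      · rw [if_neg (by exact hx)]
        apply step_eq_of_le _ _ _ _ (i, 1, 1) _ (dw1 I _ _) _ (dw1 I _ _)
        · rw [nbhd_v i hn, pd_z1]
          simp only [Finset.mem_insert, Finset.mem_singleton]
          rintro u (rfl | rfl | rfl | rfl | rfl) hu
          · simp [dw1] at hu
          · simp [dw1] at hu
          · simp [dw1] at hu
          · rw [show ((1 : Fin 2) + 1) = 0 from rfl, pd_v0 I hn i (hI i)]
            by_cases h1 : i - 1 ∈ I <;> by_cases h2 : i + 1 ∈ I <;>
              simp [h1, h2, Xor] at hx ⊢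
            split_ifs <;> norm_num
          · simp [dw1] at hu
        · rw [nbhd_v i hn]; simp
    · rw [cw1 _ _ _ (by simp)]
      apply step_eq_of_le _ _ _ _ (i, 1, 1) _ (dw1 I _ _) _ (dw1 I _ _)
      · rw [nbhd_z]
        simp only [Finset.mem_insert, Finset.mem_singleton]
        rintro u (rfl | rfl | rfl | rfl) hu <;> simp [dw1] at hu
      · rw [nbhd_z]; simp
    · rw [cw1 _ _ _ (by rcases ht with rfl | rfl <;> simp)]
      apply step_eq_of_le _ _ _ _ (i, 1, 1) _ (dw1 I _ _) _ (dw1 I _ _)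
      · rw [nbhd_x _ _ _ ht]
        simp only [Finset.mem_insert, Finset.mem_singleton]
        rintro u (rfl | rfl | rfl) hu <;> simp [dw1] at hu
      · rw [nbhd_x _ _ _ ht]; simp
  · rw [cw0]
    rcases fin4_cases t with rfl | rfl | ht
    · by_cases hi : i ∈ I
      · apply step_eq_of_lt _ _ _ _ (i, 0, 1)
        · rw [nbhd_v i hn]; simp
        · rw [nbhd_v i hn, pd_z0, if_pos hi]
          simp only [Finset.mem_insert, Finset.mem_singleton]
          rintro u (rfl | rfl | rfl | rfl | rfl) hu
          · rw [pd_v0 I hn i (hI i), if_pos hi]; norm_num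
          · simp [dwv, hI i hi] at hu
          · simp [dwv, hI i hi] at hu
          · rw [show ((0 : Fin 2) + 1) = 1 from rfl, pd_v1 I hn]; split_ifs <;> norm_num
          · simp [dw0] at hu
      · apply step_eq_of_le _ _ _ _ (i, 0, 1) _ (by simp [dwv, hi]) _ (dw0 I _ _ (by simp))
        · rw [nbhd_v i hn, pd_z0, if_neg hi]
          simp only [Finset.mem_insert, Finset.mem_singleton]
          rintro u (rfl | rfl | rfl | rfl | rfl) hu
          · simp [dwv, hi] at hu
          · have : i - 1 ∈ I := by
              by_contra h; simp [dwv, h] at hu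
            rw [pd_v0 I hn _ (hI _), if_pos this]; norm_num
          · have : i + 1 ∈ I := by
              by_contra h; simp [dwv, h] at hu
            rw [pd_v0 I hn _ (hI _), if_pos this]; norm_num
          · rw [show ((0 : Fin 2) + 1) = 1 from rfl, pd_v1 I hn]; split_ifs <;> norm_num
          · simp [dw0] at hu
        · rw [nbhd_v i hn]; simp
    · apply step_eq_of_lt _ _ _ _ (i, 0, 2)
      · rw [nbhd_z]; simp
      · rw [nbhd_z, pd_x0 _ _ _ (Or.inl rfl)]
        simp only [Finset.mem_insert, Finset.mem_singleton]
        rintro u (rfl | rfl | rfl | rfl) hu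
        · have : i ∈ I := by
            by_contra h; simp [dwv, h] at hu
          rw [pd_v0 I hn _ (hI _), if_pos this]; norm_num
        · simp [dw0] at hu
        · simp [dw0] at hu
        · simp [dw0] at hu
    · have h0 : t ≠ 0 := by rcases ht with rfl | rfl <;> simp
      apply step_eq_of_le _ _ _ _ (i, 0, 1) _ (dw0 I _ _ h0) _ (dw0 I _ _ (by simp))
      · rw [nbhd_x _ _ _ ht]
        simp only [Finset.mem_insert, Finset.mem_singleton]
        rintro u (rfl | rfl | rfl) hu <;> simp [dw0] at hu
      · rw [nbhd_x _ _ _ ht]; simp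

/-! Parity. -/

lemma val_parity_succ (hev : Even n) (i : ZMod n) :
    (((i + 1).val : ℕ) : ZMod 2) = ((i.val : ℕ) : ZMod 2) + 1 := by
  have h : 2 ∣ n := hev.two_dvd
  have e : ∀ x : ZMod n, ((x.val : ℕ) : ZMod 2) = ZMod.castHom h (ZMod 2) x := by
    intro x
    rw [ZMod.natCast_val, ZMod.castHom_apply]
  rw [e, e, map_add, map_one]

lemma val_parity_pred (hev : Even n) (i : ZMod n) :
    (((i - 1).val : ℕ) : ZMod 2) = ((i.val : ℕ) : ZMod 2) + 1 := by
  have h := val_parity_succ hev (i - 1)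
  rw [sub_add_cancel] at h
  rw [h, add_assoc, show (1 : ZMod 2) + 1 = 0 from rfl, add_zero]

lemma add_one_ne_self (p : ZMod 2) : p + 1 ≠ p := by
  revert p; decide

end Wave

theorem statement12 (n : ℕ) [NeZero n] (hn : 3 ≤ n) (hev : Even n) (k : ℕ) :
    ∃ I : Set (ZMod n), SameParity I ∧
      (configSeq (Hgraph n) (1 / 2) (CwaveConfig n {0}) k = CwaveConfig n I ∨
        configSeq (Hgraph n) (1 / 2) (CwaveConfig n {0}) k = DwaveConfig n I) ∧
      ∀ i : ZMod n,
        i ∈ I ↔ rule90 n (fun j => if j = 0 then true else false) k i = true := by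
  induction k with
  | zero =>
    refine ⟨{0}, ⟨0, ?_⟩, Or.inl rfl, ?_⟩
    · intro i hi
      rw [Set.mem_singleton_iff] at hi
      subst hi
      simp
    · intro i
      simp [rule90]
  | succ k ih =>
    obtain ⟨I, ⟨p, hp⟩, hc, hr⟩ := ih
    have hI : ∀ i ∈ I, i - 1 ∉ I ∧ i + 1 ∉ I := by
      intro i hi
      have h0 := hp i hi
      constructor
      · intro h
        have h1 := hp _ h
        rw [val_parity_pred hev, h0] at h1
        exact add_one_ne_self p h1
      · intro h
        have h1 := hp _ h
        rw [val_parity_succ hev, h0] at h1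
        exact add_one_ne_self p h1
    refine ⟨{i | Xor (i - 1 ∈ I) (i + 1 ∈ I)}, ⟨p + 1, ?_⟩, ?_, ?_⟩
    · rintro i (⟨h, -⟩ | ⟨h, -⟩)
      · rw [← hp _ h, ← val_parity_succ hev, sub_add_cancel]
      · rw [← hp _ h, ← val_parity_pred hev, add_sub_cancel_right]
    · rcases hc with hc | hc
      · right
        rw [configSeq, hc, step_Cwave I hn hI]
      · left
        rw [configSeq, hc, step_Dwave I hn hI]
    · intro i
      have key : ∀ a b : Bool, Xor (a = true) (b = true) ↔ (xor a b) = true := by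
        intro a b
        cases a <;> cases b <;> simp [Xor]
      have hm : i ∈ {i | Xor (i - 1 ∈ I) (i + 1 ∈ I)} ↔ Xor (i - 1 ∈ I) (i + 1 ∈ I) := Iff.rfl
      rw [hm, hr, hr]
      exact key _ _
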